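/- arXiv:2111.12047 — 7 statements merged into one kernel-verified Lean document; each statement's English description precedes it below -/
import Mathlib

section
/- For every integer n ≥ 1 and every real λ ≠ 0, the kernel of the linear operator L_n is the one-dimensional subspace spanned by the monomial y^{n-1}·z; that is, a homogeneous polynomial p of degree n in the variables x, y, z satisfies y·∂p/∂x − λ·z·∂p/∂z + λ·p = 0 if and only if p = c·y^{n-1}·z for some real constant c. -/
open MvPolynomial

/-- The linear operator `L_n(p) = y·∂p/∂x − λ·z·∂p/∂z + λ·p` on polynomials in
the variables `x = X 0`, `y = X 1`, `z = X 2`. -/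
noncomputable def Lop (lam : ℝ) (p : MvPolynomial (Fin 3) ℝ) : MvPolynomial (Fin 3) ℝ :=
  X 1 * pderiv 0 p - C lam * (X 2 * pderiv 2 p) + C lam * p

lemma coeff_X_mul_pderiv_self {σ R : Type*} [CommSemiring R] (i : σ) (p : MvPolynomial σ R)
    (m : σ →₀ ℕ) : coeff m (X i * pderiv i p) = coeff m p * m i := by
  classical
  rw [coeff_X_mul']
  split_ifs with h
  · have hle : Finsupp.single i 1 ≤ m := by
      rw [Finsupp.single_le_iff]
      exact Nat.one_le_iff_ne_zero.mpr (Finsupp.mem_support_iff.mp h)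
    obtain ⟨d, rfl⟩ := exists_add_of_le hle
    rw [add_tsub_cancel_left, coeff_pderiv, add_comm d]
    simp [add_comm]
  · simp [Finsupp.notMem_support_iff.mp h]

lemma coeff_Lop (lam : ℝ) (p : MvPolynomial (Fin 3) ℝ) (m : Fin 3 →₀ ℕ) :
    coeff m (Lop lam p) =
      coeff m (X 1 * pderiv 0 p) + lam * (1 - (m 2 : ℝ)) * coeff m p := by
  rw [Lop, coeff_add, coeff_sub, coeff_C_mul, coeff_C_mul, coeff_X_mul_pderiv_self]
  ring

lemma coeff_eq_zero_of_Lop_eq_zero {lam : ℝ} (hlam : lam ≠ 0) {p : MvPolynomial (Fin 3) ℝ}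
    (h : Lop lam p = 0) (m : Fin 3 →₀ ℕ) (hm : m 2 ≠ 1) : coeff m p = 0 := by
  induction hk : m 1 generalizing m with
  | zero =>
    have key := coeff_Lop lam p m
    rw [h, coeff_zero, coeff_X_mul', if_neg (by simp [hk]), zero_add] at key
    have hm' : (1 - (m 2 : ℝ)) ≠ 0 := sub_ne_zero.mpr (by exact_mod_cast hm.symm)
    simpa [hlam, hm'] using key
  | succ k ih =>
    have key := coeff_Lop lam p m
    have hz : coeff (m - Finsupp.single 1 1 + Finsupp.single 0 1) p = 0 :=
      ih _ (by simpa using hm) (by simp [hk])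
    rw [h, coeff_zero, coeff_X_mul', if_pos (by simp [hk]), coeff_pderiv, hz, zero_mul,
      zero_add] at key
    have hm' : (1 - (m 2 : ℝ)) ≠ 0 := sub_ne_zero.mpr (by exact_mod_cast hm.symm)
    simpa [hlam, hm'] using key

lemma coeff_add_single_zero_eq_zero_of_Lop_eq_zero {lam : ℝ} {p : MvPolynomial (Fin 3) ℝ}
    (h : Lop lam p = 0) (m : Fin 3 →₀ ℕ) (hm : m 2 = 1) :
    coeff (m + Finsupp.single 0 1) p = 0 := by
  have key := coeff_Lop lam p (Finsupp.single 1 1 + m)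
  rw [h, coeff_zero, coeff_X_mul, coeff_pderiv] at key
  have h0 : (m 0 : ℝ) + 1 ≠ 0 := by positivity
  simpa [hm, h0] using key

/-- The kernel of `L_n` on homogeneous polynomials of degree `n` is spanned by `y^{n-1}·z`. -/
theorem kernel_Lop_eq_span (n : ℕ) (hn : 1 ≤ n) (lam : ℝ) (hlam : lam ≠ 0)
    (p : MvPolynomial (Fin 3) ℝ) (hp : p.IsHomogeneous n) :
    Lop lam p = 0 ↔ ∃ c : ℝ, p = C c * X 1 ^ (n - 1) * X 2 := by
  constructor
  · intro h
    set d : Fin 3 →₀ ℕ := Finsupp.single 1 (n - 1) + Finsupp.single 2 1 with hd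
    refine ⟨coeff d p, ?_⟩
    have hmon : C (coeff d p) * X 1 ^ (n - 1) * X 2 = monomial d (coeff d p) := by
      rw [C_mul_X_pow_eq_monomial, X, monomial_mul, mul_one]
    rw [hmon]
    ext m
    rw [coeff_monomial]
    split_ifs with hdm
    · rw [hdm]
    · by_contra hne
      have h2 : m 2 = 1 := by
        by_contra h2
        exact hne (coeff_eq_zero_of_Lop_eq_zero hlam h m h2)
      have h0 : m 0 = 0 := by
        by_contra h0
        have hle : Finsupp.single 0 1 ≤ m := by
          rw [Finsupp.single_le_iff]
          exact Nat.one_le_iff_ne_zero.mpr h0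
        rw [← tsub_add_cancel_of_le hle] at hne
        exact hne (coeff_add_single_zero_eq_zero_of_Lop_eq_zero h _ (by simpa using h2))
      have hdeg : m.degree = n := by
        by_contra hdeg
        exact hne (hp.coeff_eq_zero hdeg)
      rw [Finsupp.degree_eq_sum, Fin.sum_univ_three] at hdeg
      apply hdm
      ext i
      fin_cases i <;> simp [hd] <;> omega
  · rintro ⟨c, rfl⟩
    simp only [Lop, Derivation.leibniz, Derivation.leibniz_pow, pderiv_C, pderiv_X]
    simp
    ring
end

section
/- For every integer n ≥ 1, every real λ ≠ 0, and every homogeneous polynomial q of degree n in the variables x, y, z, there exist a homogeneous polynomial p of degree n in x, y, z and a real constant c such that L_n(p) + q = c·x^{n-1}·z. -/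
open MvPolynomial

theorem Lop_add (lam : ℝ) (p q : MvPolynomial (Fin 3) ℝ) :
    Lop lam (p + q) = Lop lam p + Lop lam q := by
  simp only [Lop, map_add]
  ring

theorem Lop_zero (lam : ℝ) : Lop lam 0 = 0 := by
  simp [Lop]

theorem Lop_C_mul_monomial (lam r : ℝ) (a b k : ℕ) :
    Lop lam (C r * (X 0 ^ a * X 1 ^ b * X 2 ^ k)) =
      C (r * a) * (X 0 ^ (a - 1) * X 1 ^ (b + 1) * X 2 ^ k) +
        C (r * (lam * (1 - k))) * (X 0 ^ a * X 1 ^ b * X 2 ^ k) := by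
  have h0 : pderiv (R := ℝ) (0 : Fin 3) (C r * (X 0 ^ a * X 1 ^ b * X 2 ^ k)) =
      C r * (C (a : ℝ) * X 0 ^ (a - 1) * X 1 ^ b * X 2 ^ k) := by
    simp [Derivation.leibniz, Derivation.leibniz_pow, pderiv_X]
    exact Or.inl (by ring)
  have h2 : X 2 * pderiv (R := ℝ) (2 : Fin 3) (C r * (X 0 ^ a * X 1 ^ b * X 2 ^ k)) =
      C r * (C (k : ℝ) * X 0 ^ a * X 1 ^ b * X 2 ^ k) := by
    cases k <;> simp [Derivation.leibniz, Derivation.leibniz_pow, pderiv_X]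
    ring
  rw [Lop, h0, h2]
  simp only [map_mul, map_sub, map_one]
  ring

theorem isHomogeneous_C_mul_monomial (r : ℝ) {a b k n : ℕ} (h : a + b + k = n) :
    (C r * (X 0 ^ a * X 1 ^ b * X 2 ^ k) : MvPolynomial (Fin 3) ℝ).IsHomogeneous n := by
  subst h
  exact (((isHomogeneous_X_pow 0 a).mul (isHomogeneous_X_pow 1 b)).mul
    (isHomogeneous_X_pow 2 k)).C_mul r

theorem exists_Lop_add_monomial_eq_zero {lam : ℝ} (hlam : lam ≠ 0) {k : ℕ} (hk : k ≠ 1)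
    {n : ℕ} (a b : ℕ) (r : ℝ) (h : a + b + k = n) :
    ∃ p : MvPolynomial (Fin 3) ℝ, p.IsHomogeneous n ∧
      Lop lam p + C r * (X 0 ^ a * X 1 ^ b * X 2 ^ k) = 0 := by
  have hd : lam * (1 - k) ≠ 0 :=
    mul_ne_zero hlam (sub_ne_zero.2 fun h => hk (by exact_mod_cast h.symm))
  induction a generalizing b r with
  | zero =>
    refine ⟨_, isHomogeneous_C_mul_monomial (-r / (lam * (1 - k))) h, ?_⟩
    rw [Lop_C_mul_monomial, div_mul_cancel₀ _ hd]
    simp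
  | succ a ih =>
    obtain ⟨p, hp, hpr⟩ := ih (b + 1) (-r / (lam * (1 - k)) * (a + 1 : ℕ)) (by omega)
    refine ⟨_, (isHomogeneous_C_mul_monomial (-r / (lam * (1 - k))) h).add hp, ?_⟩
    rw [Lop_add, Lop_C_mul_monomial, div_mul_cancel₀ _ hd, Nat.add_sub_cancel, map_neg]
    linear_combination hpr

theorem exists_Lop_add_monomial (lam : ℝ) (hlam : lam ≠ 0) {a b k n : ℕ} (r : ℝ)
    (h : a + b + k = n) :
    ∃ p : MvPolynomial (Fin 3) ℝ, p.IsHomogeneous n ∧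
      ∃ c : ℝ, Lop lam p + C r * (X 0 ^ a * X 1 ^ b * X 2 ^ k) =
        C c * X 0 ^ (n - 1) * X 2 := by
  by_cases hk : k = 1
  · subst hk
    cases b with
    | zero =>
      refine ⟨0, isHomogeneous_zero _ _ _, r, ?_⟩
      rw [Lop_zero, show n - 1 = a by omega]
      ring
    | succ b =>
      have ha : ((a + 1 : ℕ) : ℝ) ≠ 0 := Nat.cast_ne_zero.2 a.succ_ne_zero
      refine ⟨_, isHomogeneous_C_mul_monomial (a := a + 1) (b := b) (k := 1)
        (-r / (a + 1 : ℕ)) (by omega), 0, ?_⟩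
      rw [Lop_C_mul_monomial, div_mul_cancel₀ _ ha]
      simp
  · obtain ⟨p, hp, hpr⟩ := exists_Lop_add_monomial_eq_zero hlam hk a b r h
    exact ⟨p, hp, 0, by simpa using hpr⟩

/-- For every homogeneous polynomial `q` of degree `n` there is a homogeneous polynomial `p`
of degree `n` and a constant `c` such that `L_n(p) + q = c·x^{n-1}·z`. -/
theorem exists_Lop_add_eq_smul_pow_mul (n : ℕ) (hn : 1 ≤ n) (lam : ℝ) (hlam : lam ≠ 0)
    (q : MvPolynomial (Fin 3) ℝ) (hq : q.IsHomogeneous n) :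
    ∃ p : MvPolynomial (Fin 3) ℝ, p.IsHomogeneous n ∧
      ∃ c : ℝ, Lop lam p + q = C c * X 0 ^ (n - 1) * X 2 := by
  classical
  suffices H : ∀ s ⊆ q.support, ∃ p : MvPolynomial (Fin 3) ℝ, p.IsHomogeneous n ∧
      ∃ c : ℝ, Lop lam p + ∑ v ∈ s, monomial v (coeff v q) = C c * X 0 ^ (n - 1) * X 2 by
    simpa only [support_sum_monomial_coeff] using H q.support subset_rfl
  intro s
  induction s using Finset.induction_on with
  | empty => exact fun _ => ⟨0, isHomogeneous_zero _ _ _, 0, by simp [Lop_zero]⟩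
  | insert v s hv ih =>
    intro hs
    obtain ⟨p, hp, c, hpc⟩ := ih ((Finset.subset_insert v s).trans hs)
    have hdeg : v 0 + v 1 + v 2 = n := by
      have := hq (mem_support_iff.1 (hs (Finset.mem_insert_self v s)))
      rwa [Finsupp.weight_apply, Finsupp.sum_fintype _ _ (by simp), Fin.sum_univ_three,
        Pi.one_apply, Pi.one_apply, Pi.one_apply, smul_eq_mul, smul_eq_mul, smul_eq_mul,
        mul_one, mul_one, mul_one] at this
    obtain ⟨p', hp', c', hpc'⟩ := exists_Lop_add_monomial lam hlam (coeff v q) hdeg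
    refine ⟨p + p', hp.add hp', c + c', ?_⟩
    rw [Finset.sum_insert hv, Lop_add, monomial_eq, Finsupp.prod_fintype _ _ (by simp),
      Fin.prod_univ_three, map_add]
    linear_combination hpc + hpc'
end

section
/- Let h be a C^1 function on a neighborhood W of the origin of ℝ² whose graph z = h(x,y) is invariant for X, in the sense that ∂h/∂x·(y + P(x,y,h(x,y))) + ∂h/∂y·Q(x,y,h(x,y)) = −λ·h(x,y) + R(x,y,h(x,y)) on W, and let V be a C^1 inverse Jacobi multiplier of X defined on a neighborhood of the origin of ℝ³. Then the function u(x,y) = V(x,y,h(x,y)) satisfies, on W, the identity (y + P(x,y,h(x,y)))·∂u/∂x + Q(x,y,h(x,y))·∂u/∂y = u(x,y)·(−λ + (∂P/∂x + ∂Q/∂y + ∂R/∂z)(x,y,h(x,y))). -/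
/-- Partial derivative of `f : ℝ^k → ℝ` in the `i`-th coordinate direction at `p`. -/
noncomputable def pd {k : ℕ} (f : (Fin k → ℝ) → ℝ) (i : Fin k) (p : Fin k → ℝ) : ℝ :=
  fderiv ℝ f p (Pi.single i 1)

/-- The point `(x, y, h(x,y))` of the graph of `h` over `w = (x,y)`. -/
def emb (h : (Fin 2 → ℝ) → ℝ) (w : Fin 2 → ℝ) : Fin 3 → ℝ := ![w 0, w 1, h w]

/-- A Fréchet derivative is the sum of the partial derivatives weighted by the coordinates of the
direction. -/
theorem fderiv_apply_eq_sum_pd {k : ℕ} (f : (Fin k → ℝ) → ℝ) (p v : Fin k → ℝ) :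
    fderiv ℝ f p v = ∑ i, v i * pd f i p := by
  conv_lhs => rw [pi_eq_sum_univ' v, map_sum]
  refine Finset.sum_congr rfl fun i _ => ?_
  rw [map_smul, smul_eq_mul, pd]

theorem hasFDerivAt_emb {h : (Fin 2 → ℝ) → ℝ} {w : Fin 2 → ℝ} (hh : DifferentiableAt ℝ h w) :
    HasFDerivAt (emb h)
      (ContinuousLinearMap.pi
        ![ContinuousLinearMap.proj 0, ContinuousLinearMap.proj 1, fderiv ℝ h w]) w := by
  rw [hasFDerivAt_pi']
  intro i
  fin_cases i
  · exact (ContinuousLinearMap.proj (R := ℝ) (φ := fun _ : Fin 2 => ℝ) 0).hasFDerivAt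
  · exact (ContinuousLinearMap.proj (R := ℝ) (φ := fun _ : Fin 2 => ℝ) 1).hasFDerivAt
  · exact hh.hasFDerivAt

/-- Chain rule for the partial derivatives of the restriction of a function to a graph. -/
theorem pd_comp_emb {h : (Fin 2 → ℝ) → ℝ} {V : (Fin 3 → ℝ) → ℝ} {w : Fin 2 → ℝ}
    (hV : DifferentiableAt ℝ V (emb h w)) (hh : DifferentiableAt ℝ h w) (i : Fin 2) :
    pd (fun v => V (emb h v)) i w
      = (Pi.single i 1 : Fin 2 → ℝ) 0 * pd V 0 (emb h w)
        + (Pi.single i 1 : Fin 2 → ℝ) 1 * pd V 1 (emb h w) + pd h i w * pd V 2 (emb h w) := by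
  have key : HasFDerivAt (fun v => V (emb h v)) _ w := hV.hasFDerivAt.comp w (hasFDerivAt_emb hh)
  rw [pd, key.fderiv, ContinuousLinearMap.comp_apply, fderiv_apply_eq_sum_pd, Fin.sum_univ_three]
  rfl

/-- The restriction `u(x,y) = V(x,y,h(x,y))` of an inverse Jacobi multiplier `V` of
`X = (y + P, Q, −λz + R)` to an invariant graph `z = h(x,y)` satisfies
`(y+P)·u_x + Q·u_y = u·(−λ + P_x + Q_y + R_z)` on the graph. -/
theorem restriction_of_inverseJacobiMultiplier_eq
    (lam : ℝ) (hlam : lam ≠ 0)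
    (U : Set (Fin 3 → ℝ)) (hUopen : IsOpen U) (hU0 : (0 : Fin 3 → ℝ) ∈ U)
    (P Q R : (Fin 3 → ℝ) → ℝ)
    (hP : ContDiffOn ℝ (⊤ : ℕ∞) P U) (hQ : ContDiffOn ℝ (⊤ : ℕ∞) Q U) (hR : ContDiffOn ℝ (⊤ : ℕ∞) R U)
    (hP0 : P 0 = 0) (hdP0 : fderiv ℝ P 0 = 0)
    (hQ0 : Q 0 = 0) (hdQ0 : fderiv ℝ Q 0 = 0)
    (hR0 : R 0 = 0) (hdR0 : fderiv ℝ R 0 = 0)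
    -- `h` is `C^1` on a neighborhood `W` of the origin of `ℝ²`
    (W : Set (Fin 2 → ℝ)) (hWopen : IsOpen W) (hW0 : (0 : Fin 2 → ℝ) ∈ W)
    (h : (Fin 2 → ℝ) → ℝ) (hh : ContDiffOn ℝ 1 h W)
    -- the graph `z = h(x,y)` is invariant for `X`
    (hinv : ∀ w ∈ W,
      pd h 0 w * (w 1 + P (emb h w)) + pd h 1 w * Q (emb h w)
        = -lam * h w + R (emb h w))
    -- `V` is a `C^1` inverse Jacobi multiplier of `X` on a neighborhood `U'` of the origin
    (U' : Set (Fin 3 → ℝ)) (hU'open : IsOpen U') (hU'0 : (0 : Fin 3 → ℝ) ∈ U')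
    (hU'U : U' ⊆ U)
    (V : (Fin 3 → ℝ) → ℝ) (hV : ContDiffOn ℝ 1 V U')
    (hVnz : ∀ O : Set (Fin 3 → ℝ), O ⊆ U' → IsOpen O → O.Nonempty → ∃ p ∈ O, V p ≠ 0)
    (hmult : ∀ p ∈ U',
      (p 1 + P p) * pd V 0 p + Q p * pd V 1 p + (-lam * p 2 + R p) * pd V 2 p
        - V p * (pd P 0 p + pd Q 1 p + (-lam + pd R 2 p)) = 0)
    -- the graph of `h` over `W` lies in the domain of `V`
    (hgraph : ∀ w ∈ W, emb h w ∈ U') :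
    ∀ w ∈ W,
      (w 1 + P (emb h w)) * pd (fun v => V (emb h v)) 0 w
        + Q (emb h w) * pd (fun v => V (emb h v)) 1 w
      = V (emb h w)
          * (-lam + (pd P 0 (emb h w) + pd Q 1 (emb h w) + pd R 2 (emb h w))) := by
  intro w hw
  have hhw : DifferentiableAt ℝ h w :=
    (hh.contDiffAt (hWopen.mem_nhds hw)).differentiableAt one_ne_zero
  have hVw : DifferentiableAt ℝ V (emb h w) :=
    (hV.contDiffAt (hU'open.mem_nhds (hgraph w hw))).differentiableAt one_ne_zero
  have hm := hmult _ (hgraph w hw)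
  have e1 : emb h w 1 = w 1 := rfl
  have e2 : emb h w 2 = h w := rfl
  rw [e1, e2] at hm
  have h0 := pd_comp_emb hVw hhw 0
  have h1 := pd_comp_emb hVw hhw 1
  simp only [Pi.single_eq_same, Pi.single_eq_of_ne, ne_eq, one_ne_zero, zero_ne_one,
    not_false_eq_true, one_mul, zero_mul, add_zero, zero_add] at h0 h1
  rw [h0, h1]
  linear_combination hm + pd V 2 (emb h w) * hinv w hw
end

section
/- Let A, B, c, u be C^∞ real-valued functions on a neighborhood W of the origin of ℝ² such that A(x,y) = y + a(x,y), where a vanishes at the origin together with its first-order partial derivatives, B vanishes at the origin together with its first-order partial derivatives, and c(0,0) ≠ 0. If A·∂u/∂x + B·∂u/∂y = c·u on W, then u is flat at the origin, i.e., all iterated derivatives of u at (0,0) vanish. -/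
open scoped ContDiff

section Prolongation

variable {E F : Type*} [NormedAddCommGroup E] [NormedSpace ℝ E]
  [NormedAddCommGroup F] [NormedSpace ℝ F]

/-- The zeroth order coefficient of the linear system satisfied by the pair `(U, DU)` when `U`
satisfies `DU(X) = C U`. -/
noncomputable def prolongedCoefficient (X : F → F) (C : F → E →L[ℝ] E) (w : F) :
    (E × (F →L[ℝ] E)) →L[ℝ] (E × (F →L[ℝ] E)) :=
  ((C w).comp (ContinuousLinearMap.fst ℝ E (F →L[ℝ] E))).prod
    ((fderiv ℝ C w).flip.comp (ContinuousLinearMap.fst ℝ E (F →L[ℝ] E)) +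
      (ContinuousLinearMap.compL ℝ F E E (C w) -
        (ContinuousLinearMap.compL ℝ F F E).flip (fderiv ℝ X w)).comp
        (ContinuousLinearMap.snd ℝ E (F →L[ℝ] E)))

lemma contDiffOn_prolongedCoefficient {W : Set F} (hW : IsOpen W) {X : F → F}
    (hX : ContDiffOn ℝ ∞ X W) {C : F → E →L[ℝ] E} (hC : ContDiffOn ℝ ∞ C W) :
    ContDiffOn ℝ ∞ (prolongedCoefficient X C) W := by
  have hDX : ContDiffOn ℝ ∞ (fderiv ℝ X) W := hX.fderiv_of_isOpen hW le_rfl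
  have hDC : ContDiffOn ℝ ∞ (fderiv ℝ C) W := hC.fderiv_of_isOpen hW le_rfl
  have h₁ : ContDiffOn ℝ ∞
      (fun w => (C w).comp (ContinuousLinearMap.fst ℝ E (F →L[ℝ] E))) W :=
    hC.clm_comp contDiffOn_const
  have hflip : ContDiff ℝ ∞ (fun T : F →L[ℝ] E →L[ℝ] E => T.flip) :=
    IsBoundedLinearMap.contDiff ⟨⟨fun _ _ => rfl, fun _ _ => rfl⟩, 1, one_pos, fun T => by
      rw [ContinuousLinearMap.opNorm_flip, one_mul]⟩
  have h₂ : ContDiffOn ℝ ∞ (fun w => (fderiv ℝ C w).flip) W :=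
    hflip.comp_contDiffOn hDC
  have h₃ : ContDiffOn ℝ ∞ (fun w => ContinuousLinearMap.compL ℝ F E E (C w)) W :=
    contDiffOn_const.clm_apply hC
  have h₄ : ContDiffOn ℝ ∞
      (fun w => (ContinuousLinearMap.compL ℝ F F E).flip (fderiv ℝ X w)) W :=
    contDiffOn_const.clm_apply hDX
  have hprod : ContDiff ℝ ∞ (fun T : ((E × (F →L[ℝ] E)) →L[ℝ] E) ×
      ((E × (F →L[ℝ] E)) →L[ℝ] (F →L[ℝ] E)) => T.1.prod T.2) :=
    IsBoundedLinearMap.contDiff ⟨⟨fun _ _ => rfl, fun _ _ => rfl⟩, 1, one_pos, fun T => by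
      rw [ContinuousLinearMap.opNorm_prod, one_mul]⟩
  exact hprod.comp_contDiffOn
    (h₁.prodMk ((h₂.clm_comp contDiffOn_const).add ((h₃.sub h₄).clm_comp contDiffOn_const)))

lemma prolongedCoefficient_injective {X : F → F} {C : F → E →L[ℝ] E} {w : F}
    (hN : ∀ h, fderiv ℝ X w (fderiv ℝ X w h) = 0) (hC : ∀ e, C w e = 0 → e = 0)
    (p : E × (F →L[ℝ] E)) (hp : prolongedCoefficient X C w p = 0) : p = 0 := by
  obtain ⟨e, L⟩ := p
  simp only [prolongedCoefficient, Prod.ext_iff] at hp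
  obtain ⟨h₁, h₂⟩ := hp
  have he : e = 0 := hC e h₁
  subst he
  have h₃ : ∀ h, C w (L h) = L (fderiv ℝ X w h) := fun h => by
    have := DFunLike.congr_fun h₂ h
    simpa [sub_eq_zero] using this
  have h₄ : ∀ h, L (fderiv ℝ X w h) = 0 := fun h => hC _ (by rw [h₃, hN, map_zero])
  have h₅ : L = 0 := by
    ext h
    exact hC _ (by rw [h₃, h₄])
  rw [h₅]
  rfl

lemma fderiv_prolongation {W : Set F} (hW : IsOpen W) {X : F → F} (hX : ContDiffOn ℝ ∞ X W)
    {U : F → E} (hU : ContDiffOn ℝ ∞ U W) {C : F → E →L[ℝ] E} (hC : ContDiffOn ℝ ∞ C W)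
    (heq : ∀ w ∈ W, fderiv ℝ U w (X w) = C w (U w)) {w : F} (hw : w ∈ W) :
    fderiv ℝ (fun w => (U w, fderiv ℝ U w)) w (X w) =
      prolongedCoefficient X C w (U w, fderiv ℝ U w) := by
  have hWw : W ∈ nhds w := hW.mem_nhds hw
  have dX : DifferentiableAt ℝ X w := (hX.contDiffAt hWw).differentiableAt (by simp)
  have dU : DifferentiableAt ℝ U w := (hU.contDiffAt hWw).differentiableAt (by simp)
  have dC : DifferentiableAt ℝ C w := (hC.contDiffAt hWw).differentiableAt (by simp)
  have dDU : DifferentiableAt ℝ (fderiv ℝ U) w :=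
    ((hU.fderiv_of_isOpen hW (m := ∞) le_rfl).contDiffAt hWw).differentiableAt (by simp)
  have hsymm : IsSymmSndFDerivAt ℝ U w := by
    refine (hU.contDiffAt hWw).isSymmSndFDerivAt ?_
    rw [minSmoothness_of_isRCLikeNormedField]
    exact WithTop.coe_le_coe.2 le_top
  have hev : (fun w => fderiv ℝ U w (X w)) =ᶠ[nhds w] fun w => C w (U w) :=
    Filter.eventuallyEq_of_mem hWw heq
  have hD := hev.fderiv_eq (𝕜 := ℝ)
  rw [fderiv_clm_apply dDU dX, fderiv_clm_apply dC dU] at hD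
  rw [dU.fderiv_prodMk dDU]
  refine Prod.ext (heq w hw) ?_
  ext h
  have hDh := DFunLike.congr_fun hD h
  simp only [add_apply, ContinuousLinearMap.comp_apply,
    ContinuousLinearMap.flip_apply] at hDh
  have hs := hsymm.eq (X w) h
  simp only [prolongedCoefficient, ContinuousLinearMap.prod_apply,
    add_apply, ContinuousLinearMap.comp_apply,
    sub_apply, ContinuousLinearMap.flip_apply,
    ContinuousLinearMap.compL_apply, ContinuousLinearMap.coe_fst', ContinuousLinearMap.coe_snd']
  rw [hs, ← add_sub_assoc, eq_sub_iff_add_eq, add_comm, hDh, add_comm]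

end Prolongation

/-- Let `X` be a smooth vector field vanishing at the origin with square-zero linear part, and let
`C` be smooth, with `C 0` injective. Then every smooth solution of `DU(X) = C U` is flat at the
origin. -/
theorem iteratedFDeriv_eq_zero_of_fderiv_apply_eq.{v} {F : Type v} [NormedAddCommGroup F]
    [NormedSpace ℝ F] {W : Set F} (hW : IsOpen W) (hW0 : (0 : F) ∈ W) {X : F → F}
    (hX : ContDiffOn ℝ ∞ X W) (hX0 : X 0 = 0)
    (hN : ∀ h, fderiv ℝ X 0 (fderiv ℝ X 0 h) = 0) (k : ℕ) :
    ∀ {E : Type v} [NormedAddCommGroup E] [NormedSpace ℝ E] {U : F → E} {C : F → E →L[ℝ] E},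
      ContDiffOn ℝ ∞ U W → ContDiffOn ℝ ∞ C W → (∀ e, C 0 e = 0 → e = 0) →
      (∀ w ∈ W, fderiv ℝ U w (X w) = C w (U w)) → iteratedFDeriv ℝ k U 0 = 0 := by
  induction k with
  | zero =>
    intro E _ _ U C hU hC hinj heq
    have h := heq 0 hW0
    rw [hX0, map_zero] at h
    ext m
    simpa using hinj _ h.symm
  | succ k ih =>
    intro E _ _ U C hU hC hinj heq
    have hDU : ContDiffOn ℝ ∞ (fderiv ℝ U) W := hU.fderiv_of_isOpen hW le_rfl
    have hV : ContDiffOn ℝ ∞ (fun w => (U w, fderiv ℝ U w)) W := hU.prodMk hDU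
    have h := ih hV (contDiffOn_prolongedCoefficient hW hX hC)
      (prolongedCoefficient_injective hN hinj)
      (fun w hw => fderiv_prolongation hW hX hU hC heq hw)
    have hsnd := (ContinuousLinearMap.snd ℝ E (F →L[ℝ] E)).iteratedFDeriv_comp_left
      (hV.contDiffAt (hW.mem_nhds hW0)) (i := k) (WithTop.coe_le_coe.2 le_top)
    have hsnd' : iteratedFDeriv ℝ k (fderiv ℝ U) 0 = 0 := by
      refine Eq.trans hsnd ?_
      rw [h]
      ext m
      simp
    ext m
    rw [iteratedFDeriv_succ_apply_right, hsnd']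
    simp

/-- If `A·u_x + B·u_y = c·u` on a neighborhood of the origin, where `A(x,y) = y + a(x,y)`
with `a` and `B` vanishing at the origin together with their first derivatives and
`c(0,0) ≠ 0`, then `u` is flat at the origin. -/
theorem solution_of_singular_pde_is_flat
    (W : Set (Fin 2 → ℝ)) (hWopen : IsOpen W) (hW0 : (0 : Fin 2 → ℝ) ∈ W)
    (a B c u : (Fin 2 → ℝ) → ℝ)
    (ha : ContDiffOn ℝ (⊤ : ℕ∞) a W) (hB : ContDiffOn ℝ (⊤ : ℕ∞) B W)
    (hc : ContDiffOn ℝ (⊤ : ℕ∞) c W) (hu : ContDiffOn ℝ (⊤ : ℕ∞) u W)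
    (ha0 : a 0 = 0) (hda0 : fderiv ℝ a 0 = 0)
    (hB0 : B 0 = 0) (hdB0 : fderiv ℝ B 0 = 0)
    (hc0 : c 0 ≠ 0)
    (heq : ∀ w ∈ W, (w 1 + a w) * pd u 0 w + B w * pd u 1 w = c w * u w) :
    ∀ k : ℕ, iteratedFDeriv ℝ k u 0 = 0 := by
  intro k
  let e : Fin 2 → (Fin 2 → ℝ) := fun i => Pi.single i 1
  let X : (Fin 2 → ℝ) → (Fin 2 → ℝ) := fun w => (w 1 + a w) • e 0 + B w • e 1
  have hX : ContDiffOn ℝ ∞ X W :=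
    (((contDiff_apply ℝ ℝ (1 : Fin 2)).contDiffOn.add ha).smul contDiffOn_const).add
      (hB.smul contDiffOn_const)
  have hWn : W ∈ nhds (0 : Fin 2 → ℝ) := hWopen.mem_nhds hW0
  have da : HasFDerivAt a (0 : (Fin 2 → ℝ) →L[ℝ] ℝ) 0 :=
    hda0 ▸ ((ha.contDiffAt hWn).differentiableAt (by simp)).hasFDerivAt
  have dB : HasFDerivAt B (0 : (Fin 2 → ℝ) →L[ℝ] ℝ) 0 :=
    hdB0 ▸ ((hB.contDiffAt hWn).differentiableAt (by simp)).hasFDerivAt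
  have hDX : ∀ h, fderiv ℝ X 0 h = h 1 • e 0 := fun h => by
    have := ((((ContinuousLinearMap.proj (R := ℝ) (φ := fun _ : Fin 2 => ℝ) 1).hasFDerivAt
      (x := 0)).add da).smul_const (e 0)).add (dB.smul_const (e 1))
    have hX' : fderiv ℝ X 0 = _ := this.fderiv
    rw [hX']
    simp
  refine iteratedFDeriv_eq_zero_of_fderiv_apply_eq hWopen hW0 hX ?_ ?_ k
    (C := fun w => c w • ContinuousLinearMap.id ℝ ℝ) hu (hc.smul contDiffOn_const) ?_ ?_
  · simp [X, ha0, hB0]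
  · intro h
    rw [hDX, hDX]
    simp [e]
  · intro x hx
    simpa [hc0] using hx
  · intro w hw
    simpa [X, e, pd] using heq w hw
end

section
/- Let U, U′ ⊆ ℝ^k be open sets, φ : U → U′ a C^2 diffeomorphism, and X : U → ℝ^k, Y : U′ → ℝ^k C^1 vector fields such that Dφ(x)·X(x) = Y(φ(x)) for all x ∈ U. If V : U → ℝ is a C^1 function satisfying ⟨∇V, X⟩ = V·div X on U, then the function W : U′ → ℝ defined by W(u) = det Dφ(φ^{−1}(u))·V(φ^{−1}(u)) satisfies ⟨∇W, Y⟩ = W·div Y on U′. -/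
open Filter Topology

section Determinant

variable {E : Type*} [NormedAddCommGroup E] [NormedSpace ℝ E] [FiniteDimensional ℝ E]

theorem ContinuousLinearMap.differentiable_det :
    Differentiable ℝ (fun A : E →L[ℝ] E => A.det) := by
  let b := Module.finBasis ℝ E
  have hentry (i j) : Differentiable ℝ
      (fun A : E →L[ℝ] E => LinearMap.toMatrix b b (A : E →ₗ[ℝ] E) i j) := by
    have h : (fun A : E →L[ℝ] E => LinearMap.toMatrix b b (A : E →ₗ[ℝ] E) i j)
        = fun A => (b.coord i).toContinuousLinearMap (A (b j)) := by
      ext A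
      simp [LinearMap.toMatrix_apply]
    rw [h]
    fun_prop
  have hdet : (fun A : E →L[ℝ] E => A.det) = fun A : E →L[ℝ] E =>
      ∑ σ : Equiv.Perm (Fin (Module.finrank ℝ E)), ((Equiv.Perm.sign σ : ℤ) : ℝ) *
        ∏ i, LinearMap.toMatrix b b (A : E →ₗ[ℝ] E) (σ i) i := by
    ext A
    rw [ContinuousLinearMap.det, ← LinearMap.det_toMatrix b, Matrix.det_apply']
  rw [hdet]
  fun_prop

theorem LinearMap.hasDerivAt_det_one_add_smul (M : E →ₗ[ℝ] E) :
    HasDerivAt (fun t : ℝ => LinearMap.det (1 + t • M)) (LinearMap.trace ℝ E M) 0 := by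
  let b := Module.finBasis ℝ E
  set N := LinearMap.toMatrix b b M
  set p := (Matrix.det (1 + (Polynomial.X : Polynomial ℝ) • N.map Polynomial.C)).divX.divX
  have h : (fun t : ℝ => LinearMap.det (1 + t • M))
      = fun t => 1 + N.trace * t + p.eval t * t ^ 2 := by
    ext t
    rw [← LinearMap.det_toMatrix b, map_add, map_smul, LinearMap.toMatrix_one,
      Matrix.det_one_add_smul]
  rw [h, LinearMap.trace_eq_matrix_trace ℝ b]
  have h1 := (((hasDerivAt_id (0 : ℝ)).const_mul N.trace).const_add 1).add
    ((p.hasDerivAt 0).mul ((hasDerivAt_id (0 : ℝ)).pow 2))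
  refine h1.congr_deriv ?_
  simp [N]

/-- Jacobi's formula for the derivative of the determinant at an invertible map `A`. -/
theorem ContinuousLinearMap.fderiv_det_apply {A B : E →L[ℝ] E} (hAB : A * B = 1)
    (H : E →L[ℝ] E) :
    fderiv ℝ (fun A : E →L[ℝ] E => A.det) A H
      = A.det * LinearMap.trace ℝ E (B * H : E →L[ℝ] E) := by
  have hline : HasDerivAt (fun t : ℝ => A + t • H) H 0 := by
    simpa using ((hasDerivAt_id (0 : ℝ)).smul_const H).const_add A
  have h1 := (differentiable_det (E := E) (A + (0 : ℝ) • H)).hasFDerivAt.comp_hasDerivAt 0 hline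
  have h2 := (LinearMap.hasDerivAt_det_one_add_smul
    ((B * H : E →L[ℝ] E) : E →ₗ[ℝ] E)).const_mul A.det
  have hfun : (fun A : E →L[ℝ] E => A.det) ∘ (fun t : ℝ => A + t • H)
      = fun t : ℝ => A.det * LinearMap.det (1 + t • ((B * H : E →L[ℝ] E) : E →ₗ[ℝ] E)) := by
    ext t
    have hfac : A + t • H = A * (1 + t • (B * H)) := by
      rw [mul_add, mul_smul_comm, ← mul_assoc, hAB, one_mul, mul_one]
    simp only [Function.comp_apply, hfac]
    exact LinearMap.det_comp _ _
  rw [hfun] at h1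
  simpa using h1.unique h2

end Determinant

theorem sum_pd_mul {k : ℕ} (f : (Fin k → ℝ) → ℝ) (p w : Fin k → ℝ) :
    ∑ i, pd f i p * w i = fderiv ℝ f p w := by
  conv_rhs => rw [pi_eq_sum_univ' w, map_sum]
  refine Finset.sum_congr rfl fun i _ => ?_
  rw [map_smul, smul_eq_mul, mul_comm, pd]

theorem sum_pd_eq_trace_fderiv {k : ℕ} {Y : (Fin k → ℝ) → (Fin k → ℝ)} {p : Fin k → ℝ}
    (hY : DifferentiableAt ℝ Y p) :
    ∑ i, pd (fun q => Y q i) i p = LinearMap.trace ℝ (Fin k → ℝ) (fderiv ℝ Y p) := by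
  rw [LinearMap.trace_eq_matrix_trace ℝ (Pi.basisFun ℝ (Fin k)), Matrix.trace]
  refine Finset.sum_congr rfl fun i _ => ?_
  simp [pd, fderiv_apply hY]

/-- Differentiating `Dφ · X = Y ∘ φ`, using the symmetry of the second derivative of `φ`. -/
theorem fderiv_fderiv_apply_of_conj {E F : Type*} [NormedAddCommGroup E] [NormedSpace ℝ E]
    [NormedAddCommGroup F] [NormedSpace ℝ F] {φ : E → F} {X : E → E} {Y : F → F} {x : E}
    (hφ : ContDiffAt ℝ 2 φ x) (hX : DifferentiableAt ℝ X x) (hY : DifferentiableAt ℝ Y (φ x))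
    (hconj : ∀ᶠ z in 𝓝 x, fderiv ℝ φ z (X z) = Y (φ z)) :
    fderiv ℝ (fderiv ℝ φ) x (X x)
      = (fderiv ℝ Y (φ x)).comp (fderiv ℝ φ x) - (fderiv ℝ φ x).comp (fderiv ℝ X x) := by
  have hD : DifferentiableAt ℝ (fderiv ℝ φ) x :=
    (hφ.fderiv_right (m := 1) (by norm_num)).differentiableAt (by norm_num)
  have h1 := hD.hasFDerivAt.clm_apply hX.hasFDerivAt
  have h2 := hY.hasFDerivAt.comp x (hφ.differentiableAt (by norm_num)).hasFDerivAt
  have h := h1.unique (h2.congr_of_eventuallyEq hconj)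
  have hsymm : IsSymmSndFDerivAt ℝ φ x := hφ.isSymmSndFDerivAt (by simp)
  rw [← h]
  ext v
  simp [hsymm.eq (X x) v]

/-- If `φ` is a `C²` diffeomorphism conjugating the `C¹` vector field `X` to `Y` and `V`
satisfies `⟨∇V, X⟩ = V·div X`, then `W = (det Dφ ∘ φ⁻¹)·(V ∘ φ⁻¹)` satisfies
`⟨∇W, Y⟩ = W·div Y`. -/
theorem inverseJacobiMultiplier_change_of_variables
    (k : ℕ)
    (U U' : Set (Fin k → ℝ)) (hUopen : IsOpen U) (hU'open : IsOpen U')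
    (φ ψ : (Fin k → ℝ) → (Fin k → ℝ))
    (hφ : ContDiffOn ℝ 2 φ U) (hψ : ContDiffOn ℝ 2 ψ U')
    (hφmaps : Set.MapsTo φ U U') (hψmaps : Set.MapsTo ψ U' U)
    (hψφ : ∀ x ∈ U, ψ (φ x) = x) (hφψ : ∀ u ∈ U', φ (ψ u) = u)
    (X Y : (Fin k → ℝ) → (Fin k → ℝ))
    (hX : ContDiffOn ℝ 1 X U) (hY : ContDiffOn ℝ 1 Y U')
    -- `Dφ(x)·X(x) = Y(φ(x))` on `U`
    (hconj : ∀ x ∈ U, fderiv ℝ φ x (X x) = Y (φ x))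
    (V : (Fin k → ℝ) → ℝ) (hV : ContDiffOn ℝ 1 V U)
    -- `⟨∇V, X⟩ = V·div X` on `U`
    (hmult : ∀ x ∈ U,
      (∑ i, pd V i x * X x i) = V x * ∑ i, pd (fun q => X q i) i x) :
    -- `⟨∇W, Y⟩ = W·div Y` on `U'`, where `W(u) = det Dφ(φ⁻¹(u))·V(φ⁻¹(u))`
    ∀ u ∈ U',
      (∑ i, pd (fun v => (fderiv ℝ φ (ψ v)).det * V (ψ v)) i u * Y u i)
        = ((fderiv ℝ φ (ψ u)).det * V (ψ u)) * ∑ i, pd (fun q => Y q i) i u := by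
  intro u hu
  have hx := hψmaps hu
  have hUx := hUopen.mem_nhds hx
  have hU'u := hU'open.mem_nhds hu
  have hφx : φ (ψ u) = u := hφψ u hu
  have hφc : ContDiffAt ℝ 2 φ (ψ u) := hφ.contDiffAt hUx
  have hφd : DifferentiableAt ℝ φ (ψ u) := hφc.differentiableAt (by norm_num)
  have hψd : DifferentiableAt ℝ ψ u := (hψ.contDiffAt hU'u).differentiableAt (by norm_num)
  have hXd : DifferentiableAt ℝ X (ψ u) := (hX.contDiffAt hUx).differentiableAt (by norm_num)
  have hYd : DifferentiableAt ℝ Y u := (hY.contDiffAt hU'u).differentiableAt (by norm_num)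
  have hVd : DifferentiableAt ℝ V (ψ u) := (hV.contDiffAt hUx).differentiableAt (by norm_num)
  have hDd : DifferentiableAt ℝ (fderiv ℝ φ) (ψ u) :=
    (hφc.fderiv_right (m := 1) (by norm_num)).differentiableAt (by norm_num)
  set A := fderiv ℝ φ (ψ u) with hA
  set B := fderiv ℝ ψ u with hB
  have hAB : A * B = 1 := by
    have h := hφd.hasFDerivAt.comp u hψd.hasFDerivAt
    exact h.unique ((hasFDerivAt_id u).congr_of_eventuallyEq
      (eventually_of_mem hU'u fun v hv => hφψ v hv))
  have hBA : B * A = 1 := by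
    have h := HasFDerivAt.comp (ψ u) (hφx.symm ▸ hψd.hasFDerivAt) hφd.hasFDerivAt
    rw [hφx] at h
    exact h.unique ((hasFDerivAt_id (ψ u)).congr_of_eventuallyEq
      (eventually_of_mem hUx fun v hv => hψφ v hv))
  have hBY : B (Y u) = X (ψ u) := by
    have h := hconj _ hx
    rw [hφx] at h
    rw [← h]
    exact DFunLike.congr_fun hBA (X (ψ u))
  have hdA := fderiv_fderiv_apply_of_conj hφc hXd (hφx.symm ▸ hYd)
    (eventually_of_mem hUx hconj)
  rw [hφx, ← hA] at hdA
  have htrace : LinearMap.trace ℝ (Fin k → ℝ)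
      (B * fderiv ℝ (fderiv ℝ φ) (ψ u) (X (ψ u)) : (Fin k → ℝ) →L[ℝ] (Fin k → ℝ))
      = LinearMap.trace ℝ (Fin k → ℝ) (fderiv ℝ Y u)
        - LinearMap.trace ℝ (Fin k → ℝ) (fderiv ℝ X (ψ u)) := by
    have hsub : B * fderiv ℝ (fderiv ℝ φ) (ψ u) (X (ψ u))
        = B * (fderiv ℝ Y u * A) - fderiv ℝ X (ψ u) := by
      rw [hdA]
      change B * (fderiv ℝ Y u * A - A * fderiv ℝ X (ψ u)) = _
      rw [mul_sub, ← mul_assoc B A, hBA, one_mul]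
    rw [hsub, ContinuousLinearMap.toLinearMap_sub, map_sub, ContinuousLinearMap.toLinearMap_mul,
      LinearMap.trace_mul_comm, ← ContinuousLinearMap.toLinearMap_mul, mul_assoc, hAB, mul_one]
  have hW : HasFDerivAt (fun v => (fderiv ℝ φ (ψ v)).det * V (ψ v)) _ u :=
    ((ContinuousLinearMap.differentiable_det A).hasFDerivAt.comp u
      (hDd.hasFDerivAt.comp u hψd.hasFDerivAt)).mul (hVd.hasFDerivAt.comp u hψd.hasFDerivAt)
  have hm := hmult _ hx
  rw [sum_pd_mul, sum_pd_eq_trace_fderiv hXd] at hm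
  rw [sum_pd_mul, sum_pd_eq_trace_fderiv hYd, hW.fderiv]
  simp only [add_apply, smul_apply,
    ContinuousLinearMap.comp_apply, smul_eq_mul, ← hA, ← hB, hBY, hm,
    ContinuousLinearMap.fderiv_det_apply hAB, htrace]
  ring
end

section
/- Let Y₁, Y₂ : W → ℝ and S : W → ℝ be C^1 functions on an open set W ⊆ ℝ², and consider the three-dimensional vector field Y(x,y,z) = (Y₁(x,y), Y₂(x,y), z·S(x,y)) on W × ℝ. If ṽ : W → ℝ is a C^1 function satisfying Y₁·∂ṽ/∂x + Y₂·∂ṽ/∂y = ṽ·(∂Y₁/∂x + ∂Y₂/∂y) on W (i.e., ṽ is an inverse integrating factor of the planar vector field (Y₁, Y₂)), then the function V(x,y,z) = z·ṽ(x,y) satisfies YV − V·div Y ≡ 0 on W × ℝ, where YV = Y₁·∂V/∂x + Y₂·∂V/∂y + z·S·∂V/∂z and div Y = ∂Y₁/∂x + ∂Y₂/∂y + S. -/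
/-- Projection of a point of `ℝ³` to its first two coordinates. -/
def pr (p : Fin 3 → ℝ) : Fin 2 → ℝ := ![p 0, p 1]

/-- The projection `pr` as a continuous linear map. -/
def prL : (Fin 3 → ℝ) →L[ℝ] (Fin 2 → ℝ) :=
  ContinuousLinearMap.pi ![ContinuousLinearMap.proj 0, ContinuousLinearMap.proj 1]

theorem coe_prL : ⇑prL = pr := by
  ext p i
  fin_cases i <;> rfl

theorem hasFDerivAt_pr (p : Fin 3 → ℝ) : HasFDerivAt pr prL p :=
  coe_prL ▸ prL.hasFDerivAt

/-- Partial derivatives of `z·v(x,y)`, by the product and chain rules. -/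
theorem pd_mul_comp_pr {v : (Fin 2 → ℝ) → ℝ} {p : Fin 3 → ℝ}
    (hv : DifferentiableAt ℝ v (pr p)) (i : Fin 3) :
    pd (fun q => q 2 * v (pr q)) i p =
      p 2 * fderiv ℝ v (pr p) (pr (Pi.single i 1))
        + v (pr p) * (Pi.single i 1 : Fin 3 → ℝ) 2 := by
  have hz : HasFDerivAt (fun q : Fin 3 → ℝ => q 2)
      (ContinuousLinearMap.proj 2 : (Fin 3 → ℝ) →L[ℝ] ℝ) p := hasFDerivAt_apply 2 p
  have h := hz.mul (hv.hasFDerivAt.comp p (hasFDerivAt_pr p))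
  rw [pd, HasFDerivAt.fderiv (f := fun q : Fin 3 → ℝ => q 2 * v (pr q)) h]
  simp [← coe_prL]

theorem pr_single_zero : pr (Pi.single 0 1) = Pi.single 0 1 := by
  ext i; fin_cases i <;> simp [pr]

theorem pr_single_one : pr (Pi.single 1 1) = Pi.single 1 1 := by
  ext i; fin_cases i <;> simp [pr]

theorem pr_single_two : pr (Pi.single 2 1) = 0 := by
  ext i; fin_cases i <;> simp [pr]

/-- If `ṽ` is an inverse integrating factor of the planar vector field `(Y₁, Y₂)`, then
`V(x,y,z) = z·ṽ(x,y)` is an inverse Jacobi multiplier of the three-dimensional vector field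
`Y(x,y,z) = (Y₁(x,y), Y₂(x,y), z·S(x,y))`. -/
theorem inverseJacobiMultiplier_of_decoupled_system
    (W : Set (Fin 2 → ℝ)) (hWopen : IsOpen W)
    (Y₁ Y₂ S : (Fin 2 → ℝ) → ℝ)
    (hY₁ : ContDiffOn ℝ 1 Y₁ W) (hY₂ : ContDiffOn ℝ 1 Y₂ W) (hS : ContDiffOn ℝ 1 S W)
    (v : (Fin 2 → ℝ) → ℝ) (hv : ContDiffOn ℝ 1 v W)
    -- `ṽ` is an inverse integrating factor of `(Y₁, Y₂)` on `W`
    (hiif : ∀ w ∈ W,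
      Y₁ w * pd v 0 w + Y₂ w * pd v 1 w = v w * (pd Y₁ 0 w + pd Y₂ 1 w)) :
    -- `YV − V·div Y ≡ 0` on `W × ℝ`, where `V(x,y,z) = z·ṽ(x,y)`
    ∀ p : Fin 3 → ℝ, pr p ∈ W →
      Y₁ (pr p) * pd (fun q => q 2 * v (pr q)) 0 p
        + Y₂ (pr p) * pd (fun q => q 2 * v (pr q)) 1 p
        + p 2 * S (pr p) * pd (fun q => q 2 * v (pr q)) 2 p
        - (p 2 * v (pr p)) * (pd Y₁ 0 (pr p) + pd Y₂ 1 (pr p) + S (pr p)) = 0 := by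
  intro p hp
  have hd : DifferentiableAt ℝ v (pr p) :=
    (hv.differentiableOn one_ne_zero).differentiableAt (hWopen.mem_nhds hp)
  have h := hiif (pr p) hp
  have h0 : pd (fun q => q 2 * v (pr q)) 0 p = p 2 * pd v 0 (pr p) := by
    rw [pd_mul_comp_pr hd, pr_single_zero]
    simp [pd]
  have h1 : pd (fun q => q 2 * v (pr q)) 1 p = p 2 * pd v 1 (pr p) := by
    rw [pd_mul_comp_pr hd, pr_single_one]
    simp [pd]
  have h2 : pd (fun q => q 2 * v (pr q)) 2 p = v (pr p) := by
    simp [pd_mul_comp_pr hd, pr_single_two]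
  rw [h0, h1, h2]
  linear_combination p 2 * h
end

section
/- Let g₃₀₀ and g₁₂₀ be real numbers with g₃₀₀ ≠ 0, and set F(x,y) = g₃₀₀·x³ + 3g₃₀₀·x²y + g₁₂₀·xy² + (g₁₂₀ − 2g₃₀₀)·y³. Then the polynomial v(x,y) = 1 + (g₁₂₀ − 3g₃₀₀)·x² + 2(g₁₂₀ − 3g₃₀₀)·xy + ((g₁₂₀ − 3g₃₀₀)(g₁₂₀ − 2g₃₀₀)/g₃₀₀)·y² is an inverse integrating factor of the planar system ẋ = y − F(x,y), ẏ = F(x,y); that is, the identity (y − F)·∂v/∂x + F·∂v/∂y = v·(−∂F/∂x + ∂F/∂y) holds for all real x, y. -/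
/-- The function `F(x,y) = g₃₀₀x³ + 3g₃₀₀x²y + g₁₂₀xy² + (g₁₂₀ − 2g₃₀₀)y³`. -/
def Ff (g300 g120 : ℝ) (x y : ℝ) : ℝ :=
  g300 * x ^ 3 + 3 * g300 * x ^ 2 * y + g120 * x * y ^ 2 + (g120 - 2 * g300) * y ^ 3

/-- The candidate inverse integrating factor
`v(x,y) = 1 + (g₁₂₀−3g₃₀₀)x² + 2(g₁₂₀−3g₃₀₀)xy + ((g₁₂₀−3g₃₀₀)(g₁₂₀−2g₃₀₀)/g₃₀₀)y²`. -/
noncomputable def vf (g300 g120 : ℝ) (x y : ℝ) : ℝ :=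
  1 + (g120 - 3 * g300) * x ^ 2 + 2 * (g120 - 3 * g300) * x * y
    + ((g120 - 3 * g300) * (g120 - 2 * g300) / g300) * y ^ 2

theorem hasDerivAt_cubic (a b c d t : ℝ) :
    HasDerivAt (fun s : ℝ => a * s ^ 3 + b * s ^ 2 + c * s + d)
      (3 * a * t ^ 2 + 2 * b * t + c) t := by
  have h := ((((hasDerivAt_pow 3 t).const_mul a).add ((hasDerivAt_pow 2 t).const_mul b)).add
    ((hasDerivAt_id t).const_mul c)).add_const d
  exact (h.congr_deriv (by push_cast; ring)).congr_of_eventuallyEq (.of_forall fun _ => rfl)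

theorem deriv_eq_of_eq_cubic {f : ℝ → ℝ} (a b c d t : ℝ)
    (hf : ∀ s, f s = a * s ^ 3 + b * s ^ 2 + c * s + d) :
    deriv f t = 3 * a * t ^ 2 + 2 * b * t + c := by
  rw [funext hf]
  exact (hasDerivAt_cubic a b c d t).deriv

/-- `v` is an inverse integrating factor of the planar system `ẋ = y − F, ẏ = F`:
`(y − F)·v_x + F·v_y = v·(−F_x + F_y)` for all real `x, y`. -/
theorem jerk_inverse_integrating_factor (g300 g120 : ℝ) (hg : g300 ≠ 0) :
    ∀ x y : ℝ,
      (y - Ff g300 g120 x y) * deriv (fun t => vf g300 g120 t y) x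
        + Ff g300 g120 x y * deriv (fun t => vf g300 g120 x t) y
      = vf g300 g120 x y
          * (-(deriv (fun t => Ff g300 g120 t y) x) + deriv (fun t => Ff g300 g120 x t) y) := by
  intro x y
  rw [deriv_eq_of_eq_cubic (f := fun t => vf g300 g120 t y) 0 (g120 - 3 * g300)
      (2 * (g120 - 3 * g300) * y)
      (1 + ((g120 - 3 * g300) * (g120 - 2 * g300) / g300) * y ^ 2) x
      (fun s => by simp only [vf]; ring),
    deriv_eq_of_eq_cubic (f := fun t => vf g300 g120 x t) 0
      ((g120 - 3 * g300) * (g120 - 2 * g300) / g300)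
      (2 * (g120 - 3 * g300) * x) (1 + (g120 - 3 * g300) * x ^ 2) y
      (fun s => by simp only [vf]; ring),
    deriv_eq_of_eq_cubic (f := fun t => Ff g300 g120 t y) g300 (3 * g300 * y)
      (g120 * y ^ 2) ((g120 - 2 * g300) * y ^ 3) x
      (fun s => by simp only [Ff]; ring),
    deriv_eq_of_eq_cubic (f := fun t => Ff g300 g120 x t) (g120 - 2 * g300) (g120 * x)
      (3 * g300 * x ^ 2) (g300 * x ^ 3) y
      (fun s => by simp only [Ff]; ring)]
  simp only [Ff, vf]
  field_simp
  ring
end
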